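/- For every x > 0, the unique maximizer ĉ(x) ∈ (0,∞)^m of the additive utility U over the budget set B(x) satisfies, for every i = 1,…,m, the first-order condition (U^i)'(ĉ_i(x)) = (U*)'(x) · S_i; equivalently ĉ_i(x) = I_i( (U*)'(x) · S_i ), where I_i denotes the inverse function of (U^i)'. -/

import Mathlib

open Filter Set Topology

theorem aux_coe_sum {m : ℕ} (f : Fin m → ℝ) :
    ((∑ k, f k : ℝ) : EReal) = ∑ k, ((f k : ℝ) : EReal) := by
  induction (Finset.univ : Finset (Fin m)) using Finset.induction_on with
  | empty => simp
  | insert a s ha ih => rw [Finset.sum_insert ha, Finset.sum_insert ha, EReal.coe_add, ih]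

theorem aux_sum_update {m : ℕ} (F : Fin m → ℝ → ℝ) (c : Fin m → ℝ) (i : Fin m) (a : ℝ) :
    ∑ k, F k (Function.update c i a k) = ∑ k, F k (c k) + (F i a - F i (c i)) := by
  rw [← Finset.add_sum_erase _ _ (Finset.mem_univ i),
    ← Finset.add_sum_erase _ (fun k => F k (c k)) (Finset.mem_univ i)]
  have : ∑ k ∈ Finset.univ.erase i, F k (Function.update c i a k)
      = ∑ k ∈ Finset.univ.erase i, F k (c k) := by
    apply Finset.sum_congr rfl
    intro k hk
    rw [Function.update_of_ne (Finset.ne_of_mem_erase hk)]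
  rw [this, Function.update_self]
  ring

theorem aux_tangent {f : ℝ → ℝ} {f' a : ℝ} (hf : ConcaveOn ℝ (Ioi 0) f) (ha : 0 < a)
    (hd : HasDerivAt f f' a) {t : ℝ} (ht : 0 < t) : f t ≤ f a + f' * (t - a) := by
  rcases lt_trichotomy t a with h | h | h
  · have := hf.le_slope_of_hasDerivAt (mem_Ioi.2 ht) (mem_Ioi.2 ha) h hd
    rw [slope_def_field, le_div_iff₀ (by linarith)] at this
    linarith
  · subst h; simp
  · have := hf.slope_le_of_hasDerivAt (mem_Ioi.2 ha) (mem_Ioi.2 ht) h hd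
    rw [slope_def_field, div_le_iff₀ (by linarith)] at this
    linarith

theorem aux_squeeze {g h : ℝ → ℝ} {l x : ℝ} (hg : HasDerivAt g l x) (hx : g x = h x)
    (h1 : ∀ᶠ z in 𝓝 x, g z ≤ h z) (h2 : ∀ᶠ z in 𝓝 x, h z ≤ h x + l * (z - x)) :
    HasDerivAt h l x := by
  rw [hasDerivAt_iff_isLittleO] at hg ⊢
  refine Asymptotics.IsBigO.trans_isLittleO (Asymptotics.IsBigO.of_bound 1 ?_) hg
  filter_upwards [h1, h2] with z hz1 hz2
  simp only [smul_eq_mul, Real.norm_eq_abs, one_mul]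
  rw [abs_of_nonpos (by linarith), abs_of_nonpos (by linarith)]
  linarith

theorem stmt12
    (m : ℕ) (hm : 1 ≤ m)
    (S : Fin m → ℝ) (hS : ∀ i, 0 < S i)
    (Ui : Fin m → ℝ → ℝ) (Ui' : Fin m → ℝ → ℝ)
    (hconc : ∀ i, StrictConcaveOn ℝ (Ioi 0) (Ui i))
    (hmono : ∀ i, StrictMonoOn (Ui i) (Ioi 0))
    (hderiv : ∀ i, ∀ t ∈ Ioi (0 : ℝ), HasDerivAt (Ui i) (Ui' i t) t)
    (hcont : ∀ i, ContinuousOn (Ui' i) (Ioi 0))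
    (hInada0 : ∀ i, Tendsto (Ui' i) (nhdsWithin 0 (Ioi 0)) atTop)
    (hInadaInf : ∀ i, Tendsto (Ui' i) atTop (nhds 0))
    (L : Fin m → EReal)
    (hL : ∀ i, Tendsto (fun t : ℝ => ((Ui i t : ℝ) : EReal)) (nhdsWithin 0 (Ioi 0)) (nhds (L i)))
    (U : (Fin m → ℝ) → EReal)
    (hU : ∀ c : Fin m → ℝ, U c = ∑ i, (if 0 < c i then ((Ui i (c i) : ℝ) : EReal) else L i))
    (B : ℝ → Set (Fin m → ℝ))
    (hB : ∀ x : ℝ, B x = {c | (∀ i, 0 ≤ c i) ∧ ∑ k, S k * c k ≤ x})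
    (Ustar : ℝ → EReal) (hUstar : ∀ x : ℝ, Ustar x = sSup (U '' B x)) :
    ∀ x : ℝ, 0 < x → ∀ c : Fin m → ℝ, (∀ i, 0 < c i) → c ∈ B x → U c = Ustar x →
      ∀ i, Ui' i (c i) = deriv (fun z : ℝ => (Ustar z).toReal) x * S i := by
  intro x hx c hc hcB hcU
  set V : (Fin m → ℝ) → ℝ := fun d => ∑ k, Ui k (d k) with hV
  have hUV : ∀ d : Fin m → ℝ, (∀ k, 0 < d k) → U d = ((V d : ℝ) : EReal) := by
    intro d hd
    rw [hU, hV, aux_coe_sum]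
    exact Finset.sum_congr rfl (fun k _ => by rw [if_pos (hd k)])
  have hle : ∀ z : ℝ, ∀ d : Fin m → ℝ, (∀ k, 0 < d k) → ∑ k, S k * d k ≤ z →
      ((V d : ℝ) : EReal) ≤ Ustar z := by
    intro z d hd hz
    rw [hUstar, ← hUV d hd]
    apply le_sSup
    refine ⟨d, ?_, rfl⟩
    rw [hB]
    exact ⟨fun k => (hd k).le, hz⟩
  have hcx : ∑ k, S k * c k ≤ x := by
    rw [hB] at hcB; exact hcB.2
  have hmax : ∀ d : Fin m → ℝ, (∀ k, 0 < d k) → ∑ k, S k * d k ≤ x → V d ≤ V c := by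
    intro d hd hz
    have := hle x d hd hz
    rw [← hcU, hUV c hc] at this
    exact_mod_cast this
  have hupd : ∀ d : Fin m → ℝ, (∀ k, 0 < d k) → ∀ i a, 0 < a →
      ∀ k, 0 < Function.update d i a k := by
    intro d hd i a ha k
    by_cases hk : k = i
    · subst hk; simpa using ha
    · rw [Function.update_of_ne hk]; exact hd k
  have hVupd : ∀ (d : Fin m → ℝ) i a, V (Function.update d i a) = V d + (Ui i a - Ui i (d i)) :=
    fun d i a => aux_sum_update Ui d i a
  have hSupd : ∀ (d : Fin m → ℝ) i a, ∑ k, S k * Function.update d i a k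
      = ∑ k, S k * d k + (S i * a - S i * d i) :=
    fun d i a => aux_sum_update (fun k t => S k * t) d i a
  intro i
  have hSi := hS i
  -- the budget is exhausted
  have htight : ∑ k, S k * c k = x := by
    by_contra hne
    have hlt : ∑ k, S k * c k < x := lt_of_le_of_ne hcx hne
    have hδ : 0 < (x - ∑ k, S k * c k) / S i := div_pos (by linarith) hSi
    have h1 := hmax (Function.update c i (c i + (x - ∑ k, S k * c k) / S i))
      (hupd c hc i _ (add_pos (hc i) hδ)) (by
        rw [hSupd, mul_add, mul_div_cancel₀ _ hSi.ne']; linarith)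
    rw [hVupd] at h1
    have h2 := hmono i (mem_Ioi.2 (hc i)) (mem_Ioi.2 (add_pos (hc i) hδ)) (by linarith)
    linarith
  -- common multiplier
  have hlam : ∀ j, Ui' j (c j) = Ui' i (c i) / S i * S j := by
    intro j
    by_cases hji : j = i
    · subst hji; field_simp
    have hSj := hS j
    have hdi : HasDerivAt (fun t : ℝ => Ui i (c i + t / S i)) (Ui' i (c i) * (1 / S i)) 0 := by
      have h0 : HasDerivAt (fun t : ℝ => c i + t / S i) (1 / S i) 0 :=
        ((hasDerivAt_id (0:ℝ)).div_const (S i)).const_add (c i)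
      exact HasDerivAt.comp (0:ℝ) (h₂ := Ui i) (by simpa using hderiv i (c i) (hc i)) h0
    have hdj : HasDerivAt (fun t : ℝ => Ui j (c j - t / S j)) (Ui' j (c j) * (-(1 / S j))) 0 := by
      have h0 : HasDerivAt (fun t : ℝ => c j - t / S j) (-(1 / S j)) 0 :=
        ((hasDerivAt_id (0:ℝ)).div_const (S j)).const_sub (c j)
      exact HasDerivAt.comp (0:ℝ) (h₂ := Ui j) (by simpa using hderiv j (c j) (hc j)) h0
    have hpi : ∀ᶠ t : ℝ in 𝓝 0, 0 < c i + t / S i := by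
      have : ContinuousAt (fun t : ℝ => c i + t / S i) 0 := by fun_prop
      exact this.eventually (lt_mem_nhds (by simpa using hc i))
    have hpj : ∀ᶠ t : ℝ in 𝓝 0, 0 < c j - t / S j := by
      have : ContinuousAt (fun t : ℝ => c j - t / S j) 0 := by fun_prop
      exact this.eventually (lt_mem_nhds (by simpa using hc j))
    have hloc : IsLocalMax (fun t : ℝ => Ui i (c i + t / S i) + Ui j (c j - t / S j)) 0 := by
      filter_upwards [hpi, hpj] with t hti htj
      have h1 := hmax (Function.update (Function.update c i (c i + t / S i)) j (c j - t / S j))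
        (hupd _ (hupd c hc i _ hti) j _ htj) (by
          rw [hSupd, hSupd, Function.update_of_ne hji, mul_add, mul_sub,
            mul_div_cancel₀ _ hSi.ne', mul_div_cancel₀ _ hSj.ne']
          linarith)
      rw [hVupd, hVupd, Function.update_of_ne hji] at h1
      simp only [zero_div, add_zero, sub_zero]
      linarith
    have := hloc.hasDerivAt_eq_zero (hdi.add hdj)
    field_simp at this ⊢
    linarith
  set l := Ui' i (c i) / S i with hl
  -- upper bound
  have hub : ∀ z : ℝ, 0 < l → Ustar z ≤ ((V c + l * (z - x) : ℝ) : EReal) := by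
    intro z hl0
    rw [hUstar]
    apply sSup_le
    rintro _ ⟨d, hd, rfl⟩
    rw [hB] at hd
    obtain ⟨hd0, hdz⟩ := hd
    have hstep : U d ≤ ((∑ k, (Ui k (c k) + Ui' k (c k) * (d k - c k)) : ℝ) : EReal) := by
      rw [hU, aux_coe_sum]
      apply Finset.sum_le_sum
      intro k _
      split_ifs with hk
      · exact EReal.coe_le_coe_iff.2
          (aux_tangent (hconc k).concaveOn (hc k) (hderiv k _ (hc k)) hk)
      · have hdk : d k = 0 := le_antisymm (not_lt.1 hk) (hd0 k)
        rw [hdk]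
        have hc1 : Continuous (fun t : ℝ => Ui k (c k) + Ui' k (c k) * (t - c k)) := by fun_prop
        have ht : Tendsto (fun t : ℝ => ((Ui k (c k) + Ui' k (c k) * (t - c k) : ℝ) : EReal))
            (𝓝[>] 0) (𝓝 ((Ui k (c k) + Ui' k (c k) * (0 - c k) : ℝ) : EReal)) :=
          ((continuous_coe_real_ereal.comp hc1).tendsto 0).mono_left nhdsWithin_le_nhds
        refine le_of_tendsto_of_tendsto (hL k) ht ?_
        filter_upwards [self_mem_nhdsWithin] with t ht0
        exact EReal.coe_le_coe_iff.2
          (aux_tangent (hconc k).concaveOn (hc k) (hderiv k _ (hc k)) ht0)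
    refine hstep.trans (EReal.coe_le_coe_iff.2 ?_)
    have heq : ∑ k, (Ui k (c k) + Ui' k (c k) * (d k - c k))
        = V c + l * (∑ k, S k * d k - ∑ k, S k * c k) := by
      rw [Finset.sum_add_distrib, ← Finset.sum_sub_distrib, Finset.mul_sum]
      congr 1
      apply Finset.sum_congr rfl
      intro k _
      rw [hlam k]; ring
    rw [heq, htight]
    have := mul_le_mul_of_nonneg_left (sub_le_sub_right hdz x) hl0.le
    linarith
  have hlpos : 0 < l := by
    apply div_pos _ hSi
    have h1 := aux_tangent (hconc i).concaveOn (hc i) (hderiv i _ (hc i))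
      (t := c i + 1) (by linarith [hc i])
    have h2 := hmono i (mem_Ioi.2 (hc i)) (mem_Ioi.2 (show 0 < c i + 1 by linarith [hc i]))
      (by linarith)
    linarith
  have hxV : (Ustar x).toReal = V c := by
    rw [← hcU, hUV c hc, EReal.toReal_coe]
  have hpos : ∀ᶠ z : ℝ in 𝓝 x, 0 < c i + (z - x) / S i := by
    have : ContinuousAt (fun z : ℝ => c i + (z - x) / S i) x := by fun_prop
    exact this.eventually (lt_mem_nhds (by simpa using hc i))
  have hlow : ∀ᶠ z : ℝ in 𝓝 x,
      ((V c + (Ui i (c i + (z - x) / S i) - Ui i (c i)) : ℝ) : EReal) ≤ Ustar z := by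
    filter_upwards [hpos] with z hz
    rw [← hVupd]
    apply hle z _ (hupd c hc i _ hz)
    rw [hSupd, mul_add, mul_div_cancel₀ _ hSi.ne']
    linarith
  have hg : HasDerivAt (fun z : ℝ => V c + (Ui i (c i + (z - x) / S i) - Ui i (c i))) l x := by
    have h0 : HasDerivAt (fun t : ℝ => c i + (t - x) / S i) (1 / S i) x :=
      (((hasDerivAt_id x).sub_const x).div_const (S i)).const_add (c i)
    have h1 : HasDerivAt (fun z : ℝ => Ui i (c i + (z - x) / S i)) (Ui' i (c i) * (1 / S i)) x :=
      HasDerivAt.comp x (h₂ := Ui i) (by simpa using hderiv i (c i) (hc i)) h0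
    have h2 := (h1.sub_const (Ui i (c i))).const_add (V c)
    rwa [mul_one_div] at h2
  have hmain : HasDerivAt (fun z : ℝ => (Ustar z).toReal) l x := by
    apply aux_squeeze hg
    · simp [hxV]
    · filter_upwards [hlow] with z hz
      have := EReal.toReal_le_toReal hz (EReal.coe_ne_bot _)
        (ne_top_of_le_ne_top (EReal.coe_ne_top _) (hub z hlpos))
      rwa [EReal.toReal_coe] at this
    · filter_upwards [hlow] with z hz
      have := EReal.toReal_le_toReal (hub z hlpos)
        (ne_bot_of_le_ne_bot (EReal.coe_ne_bot _) hz) (EReal.coe_ne_top _)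
      rw [EReal.toReal_coe] at this
      rw [hxV]; exact this
  rw [hmain.deriv]
  exact hlam i
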